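/- arXiv:2604.25355 — 5 statements merged into one kernel-verified Lean document; each statement's English description precedes it below -/
import Mathlib

section
/- Let L : C ⥤ D with adjunction L ⊣ R (unit η, counit ε), let L' : C' ⥤ D' with adjunction L' ⊣ R' (unit η', counit ε'), let F : C' ⥤ C and G : D' ⥤ D be functors, and let β : F ⋙ L ≅ L' ⋙ G be a natural isomorphism. Let α : R' ⋙ F ⟶ G ⋙ R be the mate of β, with components α_Y := R.map (G.map (ε'_Y)) ∘ R.map (β.hom_{R'.obj Y}) ∘ η_{F.obj (R'.obj Y)} : F.obj (R'.obj Y) → R.obj (G.obj Y). Define ψ with components ψ_X := R.map (β.inv_X) ∘ α_{L'.obj X} : F.obj (R'.obj (L'.obj X)) → R.obj (L.obj (F.obj X)). Then (F, ψ) is an oplax monad morphism from the monad R'L' on C' (unit η', multiplication μ'_X := R'.map (ε'_{L'.obj X})) to the monad RL on C (unit η, multiplication μ_X := R.map (ε_{L.obj X})): for every object X of C', (i) ψ_X ∘ F.map (η'_X) = η_{F.obj X}, and (ii) ψ_X ∘ F.map (μ'_X) = μ_{F.obj X} ∘ R.map (L.map ψ_X) ∘ ψ_{R'.obj (L'.obj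 X)}. -/
open CategoryTheory

universe v₁ v₂ v₃ v₄ u₁ u₂ u₃ u₄

/-- The mate `α : R' ⋙ F ⟶ G ⋙ R` of the natural isomorphism `β : F ⋙ L ≅ L' ⋙ G`,
with components `α_Y = R.map (G.map ε'_Y) ∘ R.map (β.hom_{R'.obj Y}) ∘ η_{F.obj (R'.obj Y)}`. -/
def mateAlpha {C : Type u₁} [Category.{v₁} C] {D : Type u₂} [Category.{v₂} D]
    {C' : Type u₃} [Category.{v₃} C'] {D' : Type u₄} [Category.{v₄} D']
    {L : C ⥤ D} {R : D ⥤ C} (adj : L ⊣ R)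
    {L' : C' ⥤ D'} {R' : D' ⥤ C'} (adj' : L' ⊣ R')
    {F : C' ⥤ C} {G : D' ⥤ D} (β : F ⋙ L ≅ L' ⋙ G) (Y : D') :
    F.obj (R'.obj Y) ⟶ R.obj (G.obj Y) :=
  adj.unit.app (F.obj (R'.obj Y)) ≫ R.map (β.hom.app (R'.obj Y)) ≫
    R.map (G.map (adj'.counit.app Y))

/-- The components `ψ_X := R.map (β.inv_X) ∘ α_{L'.obj X}`. -/
def matePsi {C : Type u₁} [Category.{v₁} C] {D : Type u₂} [Category.{v₂} D]
    {C' : Type u₃} [Category.{v₃} C'] {D' : Type u₄} [Category.{v₄} D']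
    {L : C ⥤ D} {R : D ⥤ C} (adj : L ⊣ R)
    {L' : C' ⥤ D'} {R' : D' ⥤ C'} (adj' : L' ⊣ R')
    {F : C' ⥤ C} {G : D' ⥤ D} (β : F ⋙ L ≅ L' ⋙ G) (X : C') :
    F.obj (R'.obj (L'.obj X)) ⟶ R.obj (L.obj (F.obj X)) :=
  mateAlpha adj adj' β (L'.obj X) ≫ R.map (β.inv.app X)

/-- `(F, ψ)` is an oplax monad morphism from the monad `R'L'` on `C'` (with unit `η'` and
multiplication `μ'_X = R'.map (ε'_{L'.obj X})`) to the monad `RL` on `C` (with unit `η` and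
multiplication `μ_X = R.map (ε_{L.obj X})`): the unit law (i) and the multiplication law (ii)
hold for every object `X` of `C'`. -/
theorem mate_is_oplax_monad_morphism
    {C : Type u₁} [Category.{v₁} C] {D : Type u₂} [Category.{v₂} D]
    {C' : Type u₃} [Category.{v₃} C'] {D' : Type u₄} [Category.{v₄} D']
    (L : C ⥤ D) (R : D ⥤ C) (adj : L ⊣ R)
    (L' : C' ⥤ D') (R' : D' ⥤ C') (adj' : L' ⊣ R')
    (F : C' ⥤ C) (G : D' ⥤ D) (β : F ⋙ L ≅ L' ⋙ G) (X : C') :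
    (F.map (adj'.unit.app X) ≫ matePsi adj adj' β X = adj.unit.app (F.obj X)) ∧
    (F.map (R'.map (adj'.counit.app (L'.obj X))) ≫ matePsi adj adj' β X =
      matePsi adj adj' β (R'.obj (L'.obj X)) ≫ R.map (L.map (matePsi adj adj' β X)) ≫
        R.map (adj.counit.app (L.obj (F.obj X)))) := by
  have transpose : ∀ Z : C', L.map (matePsi adj adj' β Z) ≫ adj.counit.app (L.obj (F.obj Z)) =
      β.hom.app (R'.obj (L'.obj Z)) ≫ G.map (adj'.counit.app (L'.obj Z)) ≫ β.inv.app Z := by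
    intro Z
    simp [matePsi, mateAlpha]
  constructor
  · apply (adj.homEquiv _ _).symm.injective
    have h := β.hom.naturality (adj'.unit.app X)
    dsimp at h
    rw [Adjunction.homEquiv_counit, Adjunction.homEquiv_counit, L.map_comp, Category.assoc,
      transpose, reassoc_of% h, ← G.map_comp_assoc]
    simp
  · apply (adj.homEquiv _ _).symm.injective
    have h := β.hom.naturality (R'.map (adj'.counit.app (L'.obj X)))
    dsimp at h
    have counit_comp := adj'.counit.naturality (adj'.counit.app (L'.obj X))
    dsimp at counit_comp
    have e := adj.counit.naturality
      (L.map (matePsi adj adj' β X) ≫ adj.counit.app (L.obj (F.obj X)))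
    dsimp only [Functor.comp_map, Functor.id_map, Functor.id_obj] at e
    rw [← R.map_comp, Adjunction.homEquiv_counit, Adjunction.homEquiv_counit, L.map_comp,
      L.map_comp, Category.assoc, Category.assoc, e, transpose, reassoc_of% h,
      ← G.map_comp_assoc, counit_comp, reassoc_of% (transpose (R'.obj (L'.obj X)))]
    simp
end

section
/- For every weighted transition system c : S → ((S →₀ ℝ≥0) × ℝ≥0) and every s ∈ S: ⨆_{n ∈ ℕ} Φ_c^n ⊥ s = ∑' (l : List S), W s l, where ⊥ is the constantly-0 function, Φ_c^n is the n-fold iterate of Φ_c, and ∑' is the tsum in ℝ≥0∞. -/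
open scoped NNReal ENNReal

namespace WTS

/-- The semantics operator of a weighted transition system with termination weights. -/
noncomputable def Phi {S : Type*} (c : S → ((S →₀ ℝ≥0) × ℝ≥0)) (h : S → ℝ≥0∞) :
    S → ℝ≥0∞ :=
  fun s => ((c s).2 : ℝ≥0∞) + ∑ s' ∈ (c s).1.support, ((c s).1 s' : ℝ≥0∞) * h s'

/-- The weight of a terminating path. -/
noncomputable def W {S : Type*} (c : S → ((S →₀ ℝ≥0) × ℝ≥0)) : S → List S → ℝ≥0∞
  | s, [] => ((c s).2 : ℝ≥0∞)
  | s, s' :: l => ((c s).1 s' : ℝ≥0∞) * W c s' l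

theorem tsum_list_eq_nil_add_cons {S : Type*} (f : List S → ℝ≥0∞) :
    ∑' l, f l = f [] + ∑' a, ∑' l, f (a :: l) := by
  let e : Unit ⊕ S × List S ≃ List S :=
    { toFun := Sum.elim (fun _ => []) fun p => p.1 :: p.2
      invFun := fun l => match l with
        | [] => .inl ()
        | a :: l => .inr (a, l)
      left_inv := by rintro (_ | ⟨a, l⟩) <;> rfl
      right_inv := by rintro (_ | ⟨a, l⟩) <;> rfl }
  rw [← e.tsum_eq, Summable.tsum_sum ENNReal.summable ENNReal.summable, ← ENNReal.tsum_prod]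
  simp [e]

/-- The `n`-th iterate of the semantics operator sums the weights of the paths of length
less than `n`. -/
theorem Phi_iterate_bot {S : Type*} (c : S → ((S →₀ ℝ≥0) × ℝ≥0)) (n : ℕ) (s : S) :
    (Phi c)^[n] ⊥ s = ∑' l : List S, if l.length < n then W c s l else 0 := by
  induction n generalizing s with
  | zero => simp
  | succ n ih =>
    rw [Function.iterate_succ_apply', tsum_list_eq_nil_add_cons,
      tsum_eq_sum (s := (c s).1.support)]
    · simp only [Phi, ih, ← ENNReal.tsum_mul_left]
      simp [W]
    · intro a ha
      simp [W, Finsupp.notMem_support_iff.1 ha]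

/-- the least-fixed-point semantics of a weighted transition system equals
the sum of the weights of all terminating paths. -/
theorem weighted_semantics {S : Type*} (c : S → ((S →₀ ℝ≥0) × ℝ≥0)) (s : S) :
    ⨆ n : ℕ, (Phi c)^[n] ⊥ s = ∑' l : List S, W c s l := by
  have mono (l : List S) : Monotone fun n : ℕ => if l.length < n then W c s l else 0 := by
    intro m n hmn
    dsimp only
    split_ifs <;> first | omega | simp
  have iSup_trunc (l : List S) : ⨆ n : ℕ, (if l.length < n then W c s l else 0) = W c s l := by
    refine le_antisymm (iSup_le fun n => by split_ifs <;> simp) ?_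
    exact le_iSup_of_le (l.length + 1) (by simp)
  simp_rw [Phi_iterate_bot, ENNReal.tsum_eq_iSup_sum]
  rw [iSup_comm]
  refine iSup_congr fun t => ?_
  rw [← ENNReal.finsetSum_iSup_of_monotone mono]
  simp_rw [iSup_trunc]

end WTS
end

section
/- The map λ is a distributive law of the semimodule monad over F: (naturality) for every f : X → Y, λ_Y ∘ Finsupp.mapDomain (Prod.map f id) = Prod.map (Finsupp.mapDomain f) id ∘ λ_X; (unit law) λ_X (Finsupp.single (x, r) 1) = (Finsupp.single x 1, r) for every x : X and r : ℝ≥0; (multiplication law) for every Ξ : ((X × ℝ≥0) →₀ ℝ≥0) →₀ ℝ≥0, Prod.map μ_X id (λ_{X →₀ ℝ≥0} (Finsupp.mapDomain λ_X Ξ)) = λ_X (μ_{X × ℝ≥0} Ξ), where λ_{X →₀ ℝ≥0} denotes the component of λ at the type X →₀ ℝ≥0. -/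
open scoped NNReal

namespace SemimoduleMonad

/-- Multiplication of the semimodule monad over `ℝ≥0`. -/
noncomputable def mu (X : Type*) (Ξ : (X →₀ ℝ≥0) →₀ ℝ≥0) : X →₀ ℝ≥0 :=
  Ξ.sum fun ν r => r • ν

/-- The distributive law `λ_X ν := (marginal on X, expected second component)`. -/
noncomputable def lam (X : Type*) (ν : (X × ℝ≥0) →₀ ℝ≥0) : (X →₀ ℝ≥0) × ℝ≥0 :=
  (Finsupp.mapDomain Prod.fst ν, ν.sum fun p w => w * p.2)

/-- The expected second component is the linear combination of second components. -/
theorem lam_snd (X : Type*) (ν : (X × ℝ≥0) →₀ ℝ≥0) :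
    (lam X ν).2 = Finsupp.linearCombination ℝ≥0 Prod.snd ν := rfl

/-- The marginal is a linear function of the measure. -/
theorem lam_fst (X : Type*) (ν : (X × ℝ≥0) →₀ ℝ≥0) :
    (lam X ν).1 = Finsupp.lmapDomain ℝ≥0 ℝ≥0 Prod.fst ν := rfl

/-- Multiplication of the monad is the linear extension of the identity. -/
theorem mu_eq_linearCombination (X : Type*) (Ξ : (X →₀ ℝ≥0) →₀ ℝ≥0) :
    mu X Ξ = Finsupp.linearCombination ℝ≥0 id Ξ := rfl

/-- `λ` is a distributive law of the semimodule monad over the functor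
`F X := X × ℝ≥0`: it is natural, and satisfies the unit and multiplication laws. -/
theorem lam_distLaw :
    -- naturality
    (∀ {X Y : Type} (f : X → Y),
      lam Y ∘ Finsupp.mapDomain (Prod.map f id) =
        Prod.map (Finsupp.mapDomain f) id ∘ lam X) ∧
    -- unit law
    (∀ (X : Type) (x : X) (r : ℝ≥0),
      lam X (Finsupp.single (x, r) 1) = (Finsupp.single x 1, r)) ∧
    -- multiplication law
    (∀ (X : Type) (Ξ : ((X × ℝ≥0) →₀ ℝ≥0) →₀ ℝ≥0),
      Prod.map (mu X) id (lam (X →₀ ℝ≥0) (Finsupp.mapDomain (lam X) Ξ)) =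
        lam X (mu (X × ℝ≥0) Ξ)) := by
  refine ⟨fun {X Y} f => ?_, fun X x r => ?_, fun X Ξ => ?_⟩
  · funext ν
    refine Prod.ext ?_ ?_
    · simp only [lam, Function.comp_apply, Prod.map_fst, ← Finsupp.mapDomain_comp]
      rfl
    · simp only [Function.comp_apply, Prod.map_snd, id, lam_snd,
        Finsupp.linearCombination_mapDomain]
      rfl
  · simp [lam]
  · refine Prod.ext ?_ ?_
    · rw [Prod.map_fst, mu_eq_linearCombination, mu_eq_linearCombination, lam_fst, lam_fst,
        Finsupp.apply_linearCombination, Finsupp.lmapDomain_apply,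
        Finsupp.linearCombination_mapDomain, Finsupp.linearCombination_mapDomain]
      rfl
    · rw [Prod.map_snd, id, mu_eq_linearCombination, lam_snd, lam_snd,
        Finsupp.apply_linearCombination, Finsupp.linearCombination_mapDomain]
      rfl

end SemimoduleMonad
end

section
/- The family α is a belief decomposition for the semimodule monad with respect to injective maps of observation types: (well-definedness) for every f : X → O, ν : X →₀ ℝ≥0 and o in the support of Finsupp.mapDomain f ν, the pair (m_o⁻¹ • ν|_o, o) lies in B f; (i) (section of flattening) μ_X (Finsupp.mapDomain ι_f (α_f ν)) = ν for every ν : X →₀ ℝ≥0; (ii) (naturality over O) for every h : X → Y and g : Y → O with g ∘ h = f, Finsupp.mapDomain (T̄ h) (α_f ν) = α_g (Finsupp.mapDomain h ν), where T̄ h (t, o) := (Finsupp.mapDomain h t, o); (iii) (base change) for every injective u : O → O', Finsupp.mapDomain θ_u (α_f ν) = α_{u ∘ f} ν, where θ_u (t, o) := (t, u o). -/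
open scoped NNReal

namespace SemimoduleBelief

/-- Multiplication of the semimodule monad over `ℝ≥0`. -/
noncomputable def mu (X : Type*) (Ξ : (X →₀ ℝ≥0) →₀ ℝ≥0) : X →₀ ℝ≥0 :=
  Ξ.sum fun ν r => r • ν

/-- The belief object of the semimodule monad. -/
def Bel {X O : Type*} (f : X → O) : Type _ :=
  {p : (X →₀ ℝ≥0) × O // Finsupp.mapDomain f p.1 = Finsupp.single p.2 1}

/-- The projection `ι_f`. -/
def iota {X O : Type*} (f : X → O) : Bel f → (X →₀ ℝ≥0) := fun p => p.1.1

/-- The restriction `ν|_o` of `ν` to the fibre `f⁻¹ {o}`. -/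
noncomputable def restr {X O : Type*} (f : X → O) (ν : X →₀ ℝ≥0) (o : O) : X →₀ ℝ≥0 :=
  haveI : DecidablePred fun x => f x = o := fun _ => Classical.dec _
  Finsupp.filter (fun x => f x = o) ν

theorem mapDomain_apply_eq {X O : Type*} [DecidableEq O] (f : X → O) (ν : X →₀ ℝ≥0) (o : O) :
    Finsupp.mapDomain f ν o = ∑ a ∈ ν.support with f a = o, ν a := by
  classical
  rw [Finsupp.mapDomain, Finsupp.sum_apply, Finsupp.sum, Finset.sum_filter]
  refine Finset.sum_congr rfl fun a _ => ?_
  rw [Finsupp.single_apply]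

theorem mapDomain_restr {X O : Type*} (f : X → O) (ν : X →₀ ℝ≥0) (o : O) :
    Finsupp.mapDomain f (restr f ν o) = Finsupp.single o (Finsupp.mapDomain f ν o) := by
  classical
  have hr : restr f ν o = Finsupp.filter (fun x => f x = o) ν := by
    unfold restr; congr
  rw [hr, Finsupp.mapDomain, Finsupp.sum, Finsupp.support_filter]
  have h1 : ∀ a ∈ ν.support.filter (fun x => f x = o),
      Finsupp.single (f a) (Finsupp.filter (fun x => f x = o) ν a)
        = Finsupp.single o (ν a) := by
    intro a ha
    rw [Finset.mem_filter] at ha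
    rw [Finsupp.filter_apply_pos (fun x => f x = o) ν ha.2, ha.2]
  rw [Finset.sum_congr rfl h1, ← Finsupp.single_finset_sum, mapDomain_apply_eq]

/-- Well-definedness: for `o` in the support of the pushforward, the normalized
restriction paired with `o` lies in `B f`. -/
theorem belief_mem {X O : Type*} (f : X → O) (ν : X →₀ ℝ≥0) (o : O)
    (ho : o ∈ (Finsupp.mapDomain f ν).support) :
    Finsupp.mapDomain f ((Finsupp.mapDomain f ν o)⁻¹ • restr f ν o) =
      Finsupp.single o 1 := by
  have hm : Finsupp.mapDomain f ν o ≠ 0 := Finsupp.mem_support_iff.mp ho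
  rw [Finsupp.mapDomain_smul, mapDomain_restr, Finsupp.smul_single, smul_eq_mul,
    inv_mul_cancel₀ hm]

/-- The belief decomposition `α_f` of the semimodule monad. -/
noncomputable def alpha {X O : Type*} (f : X → O) (ν : X →₀ ℝ≥0) : Bel f →₀ ℝ≥0 :=
  ∑ o ∈ (Finsupp.mapDomain f ν).support.attach,
    Finsupp.single
      (⟨(((Finsupp.mapDomain f ν) o.1)⁻¹ • restr f ν o.1, o.1),
        belief_mem f ν o.1 o.2⟩ : Bel f)
      (Finsupp.mapDomain f ν o.1)

/-- The lifted map `T̄ h`. -/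
noncomputable def Tbar {X Y O : Type*} {f : X → O} {g : Y → O} (h : X → Y) (hgf : g ∘ h = f)
    (b : Bel f) : Bel g :=
  ⟨(Finsupp.mapDomain h b.1.1, b.1.2), by
    rw [← Finsupp.mapDomain_comp, hgf]; exact b.2⟩

/-- The base-change map `θ_u`. -/
def theta {X O O' : Type*} {f : X → O} (u : O → O') (b : Bel f) : Bel (u ∘ f) :=
  ⟨(b.1.1, u b.1.2), by
    rw [Finsupp.mapDomain_comp, b.2, Finsupp.mapDomain_single]⟩

theorem restr_apply_self {X O : Type*} (f : X → O) (ν : X →₀ ℝ≥0) (x : X) :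
    restr f ν (f x) x = ν x := by
  simp [restr]

theorem restr_apply_of_ne {X O : Type*} (f : X → O) (ν : X →₀ ℝ≥0) {o : O} {x : X}
    (h : f x ≠ o) : restr f ν o x = 0 := by
  simp [restr, h]

theorem restr_comp_of_injective {X O O' : Type*} (f : X → O) {u : O → O'}
    (hu : Function.Injective u) (ν : X →₀ ℝ≥0) (o : O) :
    restr (u ∘ f) ν (u o) = restr f ν o := by
  ext x
  by_cases hx : f x = o <;> simp [restr, hx, hu.eq_iff]

theorem mapDomain_restr_comp {X Y O : Type*} (g : Y → O) (h : X → Y) (ν : X →₀ ℝ≥0) (o : O) :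
    Finsupp.mapDomain h (restr (g ∘ h) ν o) = restr g (Finsupp.mapDomain h ν) o := by
  induction ν using Finsupp.induction_linear with
  | zero => simp only [restr, Finsupp.filter_zero, Finsupp.mapDomain_zero]
  | add ν₁ ν₂ h₁ h₂ =>
    simp only [restr, Finsupp.filter_add, Finsupp.mapDomain_add] at h₁ h₂ ⊢
    rw [h₁, h₂]
  | single x r =>
    by_cases hx : g (h x) = o <;> simp [restr, hx]

theorem apply_eq_zero_of_mapDomain_apply_eq_zero {X O : Type*} (f : X → O) (ν : X →₀ ℝ≥0)
    {x : X} (h : Finsupp.mapDomain f ν (f x) = 0) : ν x = 0 := by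
  classical
  rw [mapDomain_apply_eq, Finset.sum_eq_zero_iff] at h
  by_contra hx
  exact hx (h x (by simp [hx]))

/-- A finitely supported function is the sum of its restrictions to the fibres of `f`. -/
theorem sum_restr {X O : Type*} (f : X → O) (ν : X →₀ ℝ≥0) :
    ∑ o ∈ (Finsupp.mapDomain f ν).support, restr f ν o = ν := by
  ext x
  rw [Finsupp.finsetSum_apply, Finset.sum_eq_single (f x)
    (fun o _ ho => restr_apply_of_ne f ν ho.symm), restr_apply_self]
  intro hx
  rw [restr_apply_self]
  exact apply_eq_zero_of_mapDomain_apply_eq_zero f ν (Finsupp.notMem_support_iff.mp hx)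

theorem mu_mapDomain_iota_alpha {X O : Type*} (f : X → O) (ν : X →₀ ℝ≥0) :
    mu X (Finsupp.mapDomain (iota f) (alpha f ν)) = ν := by
  rw [mu, Finsupp.sum_mapDomain_index (fun ν => zero_smul _ ν) (fun ν r s => add_smul r s ν),
    alpha, ← Finsupp.sum_finsetSum_index (fun b => zero_smul _ (iota f b))
      (fun b r s => add_smul r s (iota f b))]
  conv_rhs => rw [← sum_restr f ν, ← Finset.sum_attach]
  refine Finset.sum_congr rfl fun o _ => ?_
  exact (Finsupp.sum_single_index (by exact zero_smul _ _)).trans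
    (smul_inv_smul₀ (Finsupp.mem_support_iff.mp o.2) _)

theorem mapDomain_Tbar_alpha {X Y O : Type*} (f : X → O) (g : Y → O) (h : X → Y)
    (hgf : g ∘ h = f) (ν : X →₀ ℝ≥0) :
    Finsupp.mapDomain (Tbar h hgf) (alpha f ν) = alpha g (Finsupp.mapDomain h ν) := by
  subst hgf
  have hm : Finsupp.mapDomain (g ∘ h) ν = Finsupp.mapDomain g (Finsupp.mapDomain h ν) :=
    Finsupp.mapDomain_comp
  rw [alpha, alpha, Finsupp.mapDomain_finsetSum]
  refine Finset.sum_bij (fun o _ => ⟨o.1, hm ▸ o.2⟩) (fun _ _ => Finset.mem_attach _ _)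
    (fun _ _ _ _ e => Subtype.ext (Subtype.mk.inj e))
    (fun o _ => ⟨⟨o.1, hm.symm ▸ o.2⟩, Finset.mem_attach _ _, rfl⟩) fun o _ => ?_
  refine Finsupp.mapDomain_single.trans ?_
  congr 1
  · refine Subtype.ext (Prod.ext ?_ rfl)
    simp only [Tbar]
    rw [Finsupp.mapDomain_smul, mapDomain_restr_comp, DFunLike.congr_fun hm o.1]
  · exact DFunLike.congr_fun hm o.1

theorem mapDomain_theta_alpha {X O O' : Type*} (f : X → O) {u : O → O'}
    (hu : Function.Injective u) (ν : X →₀ ℝ≥0) :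
    Finsupp.mapDomain (theta u) (alpha f ν) = alpha (u ∘ f) ν := by
  classical
  have hm (o : O) : Finsupp.mapDomain (u ∘ f) ν (u o) = Finsupp.mapDomain f ν o := by
    rw [Finsupp.mapDomain_comp, Finsupp.mapDomain_apply hu]
  have hs : (Finsupp.mapDomain (u ∘ f) ν).support = (Finsupp.mapDomain f ν).support.image u := by
    rw [Finsupp.mapDomain_comp, Finsupp.mapDomain_support_of_injective hu]
  rw [alpha, alpha, Finsupp.mapDomain_finsetSum]
  refine Finset.sum_bij (fun o _ => ⟨u o.1, hs ▸ Finset.mem_image_of_mem u o.2⟩)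
    (fun _ _ => Finset.mem_attach _ _)
    (fun _ _ _ _ e => Subtype.ext (hu (Subtype.mk.inj e))) ?_ fun o _ => ?_
  · rintro ⟨o', ho'⟩ _
    obtain ⟨o, ho, rfl⟩ := Finset.mem_image.mp (hs ▸ ho')
    exact ⟨⟨o, ho⟩, Finset.mem_attach _ _, rfl⟩
  · refine Finsupp.mapDomain_single.trans ?_
    congr 1
    · refine Subtype.ext (Prod.ext ?_ rfl)
      simp only [theta]
      rw [hm, restr_comp_of_injective f hu]
    · rw [hm]

/-- `α` is a belief decomposition for the semimodule monad with respect to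
injective maps of observation types: it is well defined, a section of the flattening map,
natural over `O`, and compatible with injective base changes. -/
theorem alpha_beliefDecomp :
    -- well-definedness
    (∀ {X O : Type} (f : X → O) (ν : X →₀ ℝ≥0) (o : O),
      o ∈ (Finsupp.mapDomain f ν).support →
        Finsupp.mapDomain f ((Finsupp.mapDomain f ν o)⁻¹ • restr f ν o) =
          Finsupp.single o 1) ∧
    -- (i) section of flattening
    (∀ {X O : Type} (f : X → O) (ν : X →₀ ℝ≥0),
      mu X (Finsupp.mapDomain (iota f) (alpha f ν)) = ν) ∧
    -- (ii) naturality over `O`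
    (∀ {X Y O : Type} (f : X → O) (g : Y → O) (h : X → Y) (hgf : g ∘ h = f)
        (ν : X →₀ ℝ≥0),
      Finsupp.mapDomain (Tbar h hgf) (alpha f ν) = alpha g (Finsupp.mapDomain h ν)) ∧
    -- (iii) base change along injective maps
    (∀ {X O O' : Type} (f : X → O) (u : O → O'), Function.Injective u →
      ∀ ν : X →₀ ℝ≥0,
        Finsupp.mapDomain (theta u) (alpha f ν) = alpha (u ∘ f) ν) := by
  exact ⟨belief_mem, mu_mapDomain_iota_alpha, mapDomain_Tbar_alpha,
    fun f _ hu ν => mapDomain_theta_alpha f hu ν⟩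

end SemimoduleBelief
end

section
/- The family α is a belief decomposition for the nonempty powerset monad with respect to injective maps of observation types: (well-definedness) for every f : X → O and nonempty U ⊆ X, α_f U is a nonempty set of elements of B f; (i) (section of flattening) μ (T.map ι_f (α_f U)) = U, i.e. the union of the cells U ∩ f⁻¹ {o} over o ∈ f '' U equals U; (ii) (naturality over O) for every h : X → Y and g : Y → O with g ∘ h = f, T.map (T̄ h) (α_f U) = α_g (h '' U); (iii) (base change) for every injective u : O → O', T.map θ_u (α_f U) = α_{u ∘ f} U. -/
universe u

namespace PowersetBelief

/-- The nonempty powerset monad on types. -/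
def TP (X : Type u) : Type u := {U : Set X // U.Nonempty}

/-- The belief object: nonempty subsets of `X` on which `f` is constant. -/
def BP {X O : Type u} (f : X → O) : Type u :=
  {p : TP X × O // f '' p.1.1 = {p.2}}

/-- The belief decomposition `α_f U := {(U ∩ f⁻¹ {o}, o) | o ∈ f '' U}`, described as
the set of belief states whose underlying set is the cell of its observation. -/
def alphaP {X O : Type u} (f : X → O) (U : TP X) : Set (BP f) :=
  {b | b.1.1.1 = U.1 ∩ f ⁻¹' {b.1.2} ∧ b.1.2 ∈ f '' U.1}

/-- The lifted map `T̄ h (U, o) := (h '' U, o)`. -/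
def BPmap {X Y O : Type u} {f : X → O} {g : Y → O} (h : X → Y) (hgf : g ∘ h = f)
    (b : BP f) : BP g :=
  ⟨(⟨h '' b.1.1.1, b.1.1.2.image h⟩, b.1.2), by
    show g '' (h '' b.1.1.1) = {b.1.2}
    rw [← Set.image_comp, hgf]; exact b.2⟩

/-- The base-change map `θ_u (U, o) := (U, u o)`. -/
def thetaP {X O O' : Type u} {f : X → O} (u : O → O') (b : BP f) : BP (u ∘ f) :=
  ⟨(b.1.1, u b.1.2), by
    show (u ∘ f) '' b.1.1.1 = {u b.1.2}
    rw [Set.image_comp, b.2, Set.image_singleton]⟩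

theorem BP.ext {X O : Type u} {f : X → O} {b c : BP f} (h₁ : b.1.1.1 = c.1.1.1)
    (h₂ : b.1.2 = c.1.2) : b = c :=
  Subtype.ext (Prod.ext (Subtype.ext h₁) h₂)

theorem image_inter_fiber {X O : Type u} (f : X → O) (S : Set X) {o : O} (ho : o ∈ f '' S) :
    f '' (S ∩ f ⁻¹' {o}) = {o} := by
  rw [Set.image_inter_preimage, Set.inter_singleton_of_mem ho]

/-- The cell of `U` containing `x`, as a belief state. -/
def cell {X O : Type u} (f : X → O) (U : TP X) (x : U.1) : BP f :=
  ⟨(⟨U.1 ∩ f ⁻¹' {f x.1}, x.1, x.2, rfl⟩, f x.1),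
    image_inter_fiber f U.1 (Set.mem_image_of_mem f x.2)⟩

theorem alphaP_eq_range_cell {X O : Type u} (f : X → O) (U : TP X) :
    alphaP f U = Set.range (cell f U) := by
  ext b
  constructor
  · rintro ⟨hb, x, hx, hxb⟩
    refine ⟨⟨x, hx⟩, BP.ext ?_ hxb⟩
    rw [hb, ← hxb]
    rfl
  · rintro ⟨x, rfl⟩
    exact ⟨rfl, x.1, x.2, rfl⟩

theorem sUnion_alphaP {X O : Type u} (f : X → O) (U : TP X) :
    ⋃₀ ((fun V : TP X => V.1) '' ((fun b : BP f => b.1.1) '' alphaP f U)) = U.1 := by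
  rw [alphaP_eq_range_cell, Set.image_image, ← Set.range_comp, Set.sUnion_range]
  apply Set.Subset.antisymm
  · exact Set.iUnion_subset fun _ => Set.inter_subset_left
  · exact fun x hx => Set.mem_iUnion.2 ⟨⟨x, hx⟩, hx, rfl⟩

theorem BPmap_cell {X Y O : Type u} (h : X → Y) (g : Y → O) (U : TP X) (x : U.1) :
    BPmap h rfl (cell (g ∘ h) U x) =
      cell g ⟨h '' U.1, U.2.image h⟩ ⟨h x.1, Set.mem_image_of_mem h x.2⟩ :=
  BP.ext (Set.image_inter_preimage h U.1 (g ⁻¹' {g (h x.1)})) rfl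

theorem BPmap_image_alphaP {X Y O : Type u} (h : X → Y) (g : Y → O) (U : TP X) :
    BPmap h rfl '' alphaP (g ∘ h) U = alphaP g ⟨h '' U.1, U.2.image h⟩ := by
  rw [alphaP_eq_range_cell, ← Set.range_comp]
  refine Eq.trans ?_ (alphaP_eq_range_cell g ⟨h '' U.1, U.2.image h⟩).symm
  apply Set.Subset.antisymm
  · rintro _ ⟨x, rfl⟩
    exact ⟨_, (BPmap_cell h g U x).symm⟩
  · rintro _ ⟨⟨_, x, hx, rfl⟩, rfl⟩
    exact ⟨⟨x, hx⟩, BPmap_cell h g U ⟨x, hx⟩⟩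

theorem thetaP_cell {X O O' : Type u} (f : X → O) {u : O → O'} (hu : Function.Injective u)
    (U : TP X) (x : U.1) : thetaP u (cell f U x) = cell (u ∘ f) U x :=
  BP.ext (Set.ext fun _ => and_congr_right fun _ => hu.eq_iff.symm) rfl

theorem thetaP_image_alphaP {X O O' : Type u} (f : X → O) {u : O → O'}
    (hu : Function.Injective u) (U : TP X) :
    thetaP u '' alphaP f U = alphaP (u ∘ f) U := by
  rw [alphaP_eq_range_cell, alphaP_eq_range_cell, ← Set.range_comp]
  exact congrArg Set.range (funext (thetaP_cell f hu U))

/-- `α` is a belief decomposition for the nonempty powerset monad with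
respect to injective maps of observation types: it is well defined (each cell is
nonempty with `f` constant on it, and `α_f U` is nonempty), it is a section of the
flattening map (the union of the cells recovers `U`), it is natural over `O`, and it is
compatible with injective base changes. -/
theorem alphaP_beliefDecomp {X Y O O' : Type u} (f : X → O) (U : TP X) :
    -- well-definedness
    ((∀ o ∈ f '' U.1, (U.1 ∩ f ⁻¹' {o}).Nonempty ∧ f '' (U.1 ∩ f ⁻¹' {o}) = {o}) ∧
      (alphaP f U).Nonempty) ∧
    -- (i) section of flattening
    (⋃₀ ((fun V : TP X => V.1) '' ((fun b : BP f => b.1.1) '' alphaP f U)) = U.1) ∧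
    -- (ii) naturality over `O`
    (∀ (h : X → Y) (g : Y → O) (hgf : g ∘ h = f),
      BPmap h hgf '' alphaP f U = alphaP g ⟨h '' U.1, U.2.image h⟩) ∧
    -- (iii) base change along injective maps
    (∀ u : O → O', Function.Injective u →
      thetaP u '' alphaP f U = alphaP (u ∘ f) U) := by
  refine ⟨⟨fun o ho => ?_, ?_⟩, sUnion_alphaP f U, ?_, fun u hu => thetaP_image_alphaP f hu U⟩
  · have hcell := image_inter_fiber f U.1 ho
    exact ⟨Set.image_nonempty.1 (hcell ▸ Set.singleton_nonempty o), hcell⟩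
  · obtain ⟨x, hx⟩ := U.2
    rw [alphaP_eq_range_cell]
    exact ⟨_, ⟨x, hx⟩, rfl⟩
  · rintro h g rfl
    exact BPmap_image_alphaP h g U

end PowersetBelief
end
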